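/- For every natural number n ≥ 0 and every real x, T_{n+2}(x) = ∑_{m : n ≤ 3m and 2m ≤ n} h_{m, n−2m} · 12^{m+1} · m! · x^{3m−n}/(3m−n)!, where the sum is over all integers m with n/3 ≤ m ≤ n/2. -/

import Mathlib

open Polynomial

/-- The triple of polynomial families `(R n, S n, T n)` defined by the recurrence
`R_{n+1} = R_n' + 2X·S_n`, `S_{n+1} = R_n + S_n' + X·T_n`, `T_{n+1} = 2S_n + T_n'`
with `R_0 = 1`, `S_0 = 0`, `T_0 = 0`. -/
noncomputable def airyRST : ℕ → Polynomial ℝ × Polynomial ℝ × Polynomial ℝ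
  | 0 => (1, 0, 0)
  | n + 1 =>
      ((airyRST n).1.derivative + 2 * X * (airyRST n).2.1,
       (airyRST n).1 + (airyRST n).2.1.derivative + X * (airyRST n).2.2,
       2 * (airyRST n).2.1 + (airyRST n).2.2.derivative)

noncomputable def airyR (n : ℕ) : Polynomial ℝ := (airyRST n).1
noncomputable def airyS (n : ℕ) : Polynomial ℝ := (airyRST n).2.1
noncomputable def airyT (n : ℕ) : Polynomial ℝ := (airyRST n).2.2

/-- The coefficient
`h_{m,k} = (1/(2·3^{m+1})) ∑_{j=0}^{⌊k/2⌋} C(m+j,m)·Γ(m+k−j+3/2)/((k−2j)!·Γ(j+m+3/2))·(−1/3)^j`. -/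
noncomputable def airyCoeffH (m k : ℕ) : ℝ :=
  (1 / (2 * 3 ^ (m + 1))) *
    ∑ j ∈ Finset.range (k / 2 + 1),
      (Nat.choose (m + j) m : ℝ) * Real.Gamma ((m : ℝ) + k - j + 3 / 2) /
        ((Nat.factorial (k - 2 * j) : ℝ) * Real.Gamma ((j : ℝ) + m + 3 / 2)) *
        (-1 / 3 : ℝ) ^ j

theorem airyRST_succ (n : ℕ) :
    airyR (n + 1) = (airyR n).derivative + 2 * X * airyS n ∧
      airyS (n + 1) = airyR n + (airyS n).derivative + X * airyT n ∧
      airyT (n + 1) = 2 * airyS n + (airyT n).derivative :=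
  ⟨rfl, rfl, rfl⟩

/-- Each of the three families satisfies the recurrence coming from the third-order equation
`y''' = 4 (x + t) y' + 2 y` for products of Airy functions. -/
theorem airyRST_add_three (n : ℕ) :
    airyR (n + 3) = 4 * X * airyR (n + 1) + (4 * (n : ℝ[X]) + 2) * airyR n ∧
      airyS (n + 3) = 4 * X * airyS (n + 1) + (4 * (n : ℝ[X]) + 2) * airyS n ∧
      airyT (n + 3) = 4 * X * airyT (n + 1) + (4 * (n : ℝ[X]) + 2) * airyT n := by
  induction n with
  | zero =>
    refine ⟨?_, ?_, ?_⟩ <;> (simp [airyR, airyS, airyT, airyRST]; try ring)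
  | succ n ih =>
    obtain ⟨hR, hS, hT⟩ := ih
    obtain ⟨r₃, s₃, t₃⟩ := airyRST_succ (n + 3)
    obtain ⟨r₁, s₁, t₁⟩ := airyRST_succ (n + 1)
    obtain ⟨r₀, s₀, t₀⟩ := airyRST_succ n
    have hX : derivative (4 * X : ℝ[X]) = 4 := by simp
    have hn : derivative (4 * (n : ℝ[X]) + 2) = 0 := by simp
    refine ⟨?_, ?_, ?_⟩
    · rw [show n + 1 + 3 = n + 3 + 1 by ring, r₃, hR, hS, r₁]
      simp only [derivative_add, derivative_mul (f := 4 * X),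
        derivative_mul (f := 4 * (n : ℝ[X]) + 2), hX, hn]
      push_cast
      linear_combination (-(4 * (n : ℝ[X]) + 2)) * r₀
    · rw [show n + 1 + 3 = n + 3 + 1 by ring, s₃, hR, hS, hT, s₁]
      simp only [derivative_add, derivative_mul (f := 4 * X),
        derivative_mul (f := 4 * (n : ℝ[X]) + 2), hX, hn]
      push_cast
      linear_combination (-(4 * (n : ℝ[X]) + 2)) * s₀
    · rw [show n + 1 + 3 = n + 3 + 1 by ring, t₃, hS, hT, t₁]
      simp only [derivative_add, derivative_mul (f := 4 * X),
        derivative_mul (f := 4 * (n : ℝ[X]) + 2), hX, hn]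
      push_cast
      linear_combination (-(4 * (n : ℝ[X]) + 2)) * t₀

/-- The `j`-th summand of `2 * airyCoeffH m k`, extended by zero to all `j`. -/
noncomputable def airySummand (m k j : ℕ) : ℝ :=
  if 2 * j ≤ k then
    1 / 3 ^ (m + 1) * ((Nat.choose (m + j) m : ℝ) *
      Real.Gamma ((m : ℝ) + j + 3 / 2 + (k - 2 * j : ℕ)) /
        ((Nat.factorial (k - 2 * j) : ℝ) * Real.Gamma ((m : ℝ) + j + 3 / 2)) * (-1 / 3 : ℝ) ^ j)
  else 0

theorem airySummand_add (m j i : ℕ) :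
    airySummand m (2 * j + i) j = 1 / 3 ^ (m + 1) * ((Nat.choose (m + j) m : ℝ) *
      Real.Gamma ((m : ℝ) + j + 3 / 2 + i) /
        ((Nat.factorial i : ℝ) * Real.Gamma ((m : ℝ) + j + 3 / 2)) * (-1 / 3 : ℝ) ^ j) := by
  simp [airySummand]

theorem airySummand_of_lt {m k j : ℕ} (h : k < 2 * j) : airySummand m k j = 0 :=
  if_neg (by omega)

theorem two_mul_airyCoeffH (m : ℕ) {k N : ℕ} (hN : k / 2 + 1 ≤ N) :
    2 * airyCoeffH m k = ∑ j ∈ Finset.range N, airySummand m k j := by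
  have hsub : Finset.range (k / 2 + 1) ⊆ Finset.range N := Finset.range_mono hN
  rw [← Finset.sum_subset hsub fun j _ hj => airySummand_of_lt (by
    simp only [Finset.mem_range] at hj; omega)]
  rw [airyCoeffH, ← mul_assoc, Finset.mul_sum]
  refine Finset.sum_congr rfl fun j hj => ?_
  have hjk : 2 * j ≤ k := by simp only [Finset.mem_range] at hj; omega
  obtain ⟨i, rfl⟩ := Nat.exists_eq_add_of_le hjk
  rw [airySummand_add, Nat.add_sub_cancel_left]
  have h₁ : (m : ℝ) + (2 * j + i : ℕ) - j + 3 / 2 = (m : ℝ) + j + 3 / 2 + i := by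
    push_cast; ring
  rw [h₁, add_comm (j : ℝ) m]
  field_simp

theorem succ_mul_choose_add_succ_left (m j : ℕ) :
    ((m : ℝ) + 1) * (Nat.choose (m + 1 + j) (m + 1) : ℝ) =
      (m + j + 1) * (Nat.choose (m + j) m : ℝ) := by
  have h := Nat.add_one_mul_choose_eq (m + j) m
  rw [show m + 1 + j = m + j + 1 by ring]
  have h' : ((m : ℝ) + j + 1) * (Nat.choose (m + j) m : ℝ) =
      (Nat.choose (m + j + 1) (m + 1) : ℝ) * (m + 1) := by exact_mod_cast h
  linarith

theorem succ_mul_choose_add_succ_right (m j : ℕ) :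
    ((j : ℝ) + 1) * (Nat.choose (m + (j + 1)) m : ℝ) =
      (m + j + 1) * (Nat.choose (m + j) m : ℝ) := by
  have h := succ_mul_choose_add_succ_left j m
  rw [show j + 1 + m = m + (j + 1) by ring, Nat.choose_symm_add.symm,
    Nat.add_comm j m, ← Nat.choose_symm_add] at h
  linarith

/-- The recurrence for `airyCoeffH` holds for the summands up to a telescoping term. -/
theorem airySummand_succ (m k j : ℕ) :
    6 * ((m : ℝ) + 1) * airySummand (m + 1) (k + 1) j =
      2 * ((m : ℝ) - k) * airySummand m (k + 1) j + (2 * k + 4 * m + 5) * airySummand m k j +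
        (6 * j * airySummand m (k + 1) j - 6 * (j + 1 : ℕ) * airySummand m (k + 1) (j + 1)) := by
  have hC₁ := succ_mul_choose_add_succ_left m j
  have hC₂ := succ_mul_choose_add_succ_right m j
  have e₁ : (Nat.choose (m + 1 + j) (m + 1) : ℝ) =
      (m + j + 1) * (Nat.choose (m + j) m : ℝ) / (m + 1) := by
    rw [eq_div_iff (by positivity)]; linarith
  have ha : (0 : ℝ) < (m : ℝ) + j + 3 / 2 := by positivity
  have hshift : ((m + 1 : ℕ) : ℝ) + j + 3 / 2 = (m : ℝ) + j + 3 / 2 + 1 := by push_cast; ring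
  have hshift' : (m : ℝ) + (j + 1 : ℕ) + 3 / 2 = (m : ℝ) + j + 3 / 2 + 1 := by push_cast; ring
  have hG := Real.Gamma_add_one ha.ne'
  have hGpos := Real.Gamma_pos_of_pos ha
  rcases lt_or_ge (k + 1) (2 * j) with hlt | hge
  · rw [airySummand_of_lt hlt, airySummand_of_lt hlt, airySummand_of_lt (by omega : k < 2 * j),
      airySummand_of_lt (by omega : k + 1 < 2 * (j + 1))]
    ring
  obtain ⟨i, hi⟩ := Nat.exists_eq_add_of_le hge
  rcases i with _ | _ | r
  · have hk : (k : ℝ) = 2 * j - 1 := by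
      have : ((k + 1 : ℕ) : ℝ) = (2 * j + 0 : ℕ) := by rw [hi]
      push_cast at this; linarith
    rw [airySummand_of_lt (by omega : k < 2 * j),
      airySummand_of_lt (by omega : k + 1 < 2 * (j + 1)), hi, airySummand_add, airySummand_add,
      hshift, hk]
    simp only [Nat.cast_zero, add_zero, hG, Nat.factorial_zero]
    rw [e₁]
    field_simp
    ring
  · obtain rfl : k = 2 * j := by omega
    rw [airySummand_of_lt (by omega : 2 * j + 1 < 2 * (j + 1))]
    have h₀ := airySummand_add m j 0
    rw [add_zero] at h₀
    rw [h₀, airySummand_add, airySummand_add, hshift]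
    have hG' := Real.Gamma_add_one (by positivity : (m : ℝ) + j + 3 / 2 + 1 ≠ 0)
    simp only [Nat.cast_zero, add_zero, Nat.cast_one, hG', hG, Nat.factorial_zero,
      Nat.factorial_one]
    push_cast
    generalize Real.Gamma ((m : ℝ) + j + 3 / 2) = G at *
    rw [e₁]
    field_simp
    ring
  · obtain rfl : k = 2 * j + (r + 1) := by omega
    have e₂ : 2 * j + (r + 1) + 1 = 2 * (j + 1) + r := by ring
    have h₂ := airySummand_add m (j + 1) r
    rw [← e₂, hshift'] at h₂
    have h₁ := airySummand_add (m + 1) j (r + 2)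
    rw [hshift] at h₁
    rw [h₂, show 2 * j + (r + 1) + 1 = 2 * j + (r + 2) by ring, h₁, airySummand_add,
      airySummand_add]
    set a : ℝ := (m : ℝ) + j + 3 / 2 with ha_def
    have g₁ := Real.Gamma_add_one (by positivity : a + 1 + r ≠ 0)
    have g₂ := Real.Gamma_add_one (by positivity : a + 1 + r + 1 ≠ 0)
    have s₁ : a + 1 + ((r + 2 : ℕ) : ℝ) = a + 1 + r + 1 + 1 := by push_cast; ring
    have s₂ : a + ((r + 2 : ℕ) : ℝ) = a + 1 + r + 1 := by push_cast; ring
    have s₃ : a + ((r + 1 : ℕ) : ℝ) = a + 1 + r := by push_cast; ring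
    rw [s₁, s₂, s₃, g₂, g₁, hG, Nat.factorial_succ (r + 1), Nat.factorial_succ r]
    have hf : (Nat.factorial r : ℝ) ≠ 0 := by positivity
    have e₃ : (Nat.choose (m + (j + 1)) m : ℝ) =
        (m + j + 1) * (Nat.choose (m + j) m : ℝ) / (j + 1) := by
      rw [eq_div_iff (by positivity)]; linarith
    rw [e₁, e₃]
    generalize Real.Gamma (a + 1 + r) = g at *
    generalize Real.Gamma a = G at *
    push_cast
    field_simp
    rw [ha_def]
    ring

theorem airyCoeffH_succ_zero (m : ℕ) :
    3 * airyCoeffH (m + 1) 0 = airyCoeffH m 0 := by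
  have h (m : ℕ) : 2 * airyCoeffH m 0 = 1 / 3 ^ (m + 1) := by
    have hpos : Real.Gamma ((m : ℝ) + 3 / 2) ≠ 0 := (Real.Gamma_pos_of_pos (by positivity)).ne'
    rw [two_mul_airyCoeffH m (le_refl _)]
    simp [airySummand, hpos]
  have h₁ := h (m + 1)
  have h₀ := h m
  rw [pow_succ] at h₁
  have h₃ : (1 : ℝ) / (3 ^ (m + 1) * 3) = 1 / 3 ^ (m + 1) / 3 := by field_simp
  linarith

theorem airyCoeffH_succ_succ (m k : ℕ) :
    6 * ((m : ℝ) + 1) * airyCoeffH (m + 1) (k + 1) =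
      2 * ((m : ℝ) - k) * airyCoeffH m (k + 1) + (2 * k + 4 * m + 5) * airyCoeffH m k := by
  have h₁ := two_mul_airyCoeffH (m + 1) (k := k + 1) (N := k + 2) (by omega)
  have h₂ := two_mul_airyCoeffH m (k := k + 1) (N := k + 2) (by omega)
  have h₃ := two_mul_airyCoeffH m (k := k) (N := k + 2) (by omega)
  have hsum := Finset.sum_congr (rfl : Finset.range (k + 2) = Finset.range (k + 2))
    fun j _ => airySummand_succ m k j
  rw [Finset.sum_add_distrib, Finset.sum_add_distrib,
    Finset.sum_range_sub' (fun j => 6 * (j : ℝ) * airySummand m (k + 1) j),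
    airySummand_of_lt (by omega : k + 1 < 2 * (k + 2)), ← Finset.mul_sum, ← Finset.mul_sum,
    ← Finset.mul_sum, ← h₁, ← h₂, ← h₃] at hsum
  push_cast at hsum
  linarith

/-- The `m`-th summand in the expansion of `airyT (n + 2)`, extended by zero to all `m`. -/
noncomputable def airyTTerm (x : ℝ) (n m : ℕ) : ℝ :=
  if n ≤ 3 * m ∧ 2 * m ≤ n then
    airyCoeffH m (n - 2 * m) * 12 ^ (m + 1) * (Nat.factorial m : ℝ) *
      x ^ (3 * m - n) / (Nat.factorial (3 * m - n) : ℝ)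
  else 0

theorem airyTTerm_of_not {x : ℝ} {n m : ℕ} (h : ¬(n ≤ 3 * m ∧ 2 * m ≤ n)) :
    airyTTerm x n m = 0 :=
  if_neg h

theorem airyTTerm_eq (x : ℝ) {n m k p : ℕ} (hk : n = 2 * m + k) (hp : m = k + p) :
    airyTTerm x n m =
      airyCoeffH m k * 12 ^ (m + 1) * (Nat.factorial m : ℝ) * x ^ p / (Nat.factorial p : ℝ) := by
  rw [airyTTerm, if_pos (by omega), show n - 2 * m = k by omega, show 3 * m - n = p by omega]

theorem airyTTerm_succ (x : ℝ) (n m : ℕ) :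
    airyTTerm x (n + 3) (m + 1) =
      4 * x * airyTTerm x (n + 1) m + (4 * n + 10) * airyTTerm x n m := by
  by_cases h : n ≤ 3 * m ∧ 2 * m ≤ n + 1
  swap
  · rw [airyTTerm_of_not (by omega), airyTTerm_of_not (by omega), airyTTerm_of_not (by omega)]
    ring
  obtain ⟨k, hk⟩ := Nat.exists_eq_add_of_le h.2
  obtain ⟨p, hp⟩ := Nat.exists_eq_add_of_le (show k ≤ m + 1 by omega)
  rw [airyTTerm_eq x (k := k) (p := p) (by omega) hp]
  rcases k with _ | k
  · rw [airyTTerm_of_not (n := n) (by omega)]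
    obtain rfl : p = m + 1 := by omega
    rw [airyTTerm_eq x (k := 0) (p := m) (by omega) (by omega)]
    have h₀ := airyCoeffH_succ_zero m
    rw [Nat.factorial_succ]
    push_cast
    field_simp
    linear_combination 48 * x * x ^ m * 12 ^ m * h₀
  · have h₁ := airyCoeffH_succ_succ m k
    rw [airyTTerm_eq x (n := n) (k := k) (p := p) (by omega) (by omega)]
    have hn : (n : ℝ) = 2 * m + k := by exact_mod_cast (by omega : n = 2 * m + k)
    have hm : (m : ℝ) = k + p := by exact_mod_cast (by omega : m = k + p)
    rcases p with _ | p
    · rw [airyTTerm_of_not (n := n + 1) (by omega), Nat.factorial_succ, hn]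
      rw [show (m : ℝ) - k = 0 by rw [hm]; simp] at h₁
      push_cast
      field_simp
      linear_combination 24 * (Nat.factorial m : ℝ) * 12 ^ m * h₁
    · rw [airyTTerm_eq x (n := n + 1) (k := k + 1) (p := p) (by omega) (by omega),
        Nat.factorial_succ m, Nat.factorial_succ p, hn]
      rw [show (m : ℝ) - k = p + 1 by rw [hm]; push_cast; ring] at h₁
      push_cast
      field_simp
      linear_combination 24 * x * x ^ p * 12 ^ m * h₁

theorem sum_airyTTerm (x : ℝ) {n N : ℕ} (h : n + 1 ≤ N) :
    ∑ m ∈ Finset.range (n + 1), airyTTerm x n m = ∑ m ∈ Finset.range N, airyTTerm x n m :=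
  Finset.sum_subset (Finset.range_mono h) fun m _ hm => airyTTerm_of_not (by
    simp only [Finset.mem_range] at hm; omega)

theorem eval_airyT_add_two (x : ℝ) (n : ℕ) :
    (airyT (n + 2)).eval x = ∑ m ∈ Finset.range (n + 1), airyTTerm x n m := by
  induction n using Nat.strong_induction_on with
  | _ n ih =>
    rcases n with _ | _ | _ | n
    · rw [Finset.sum_range_one, airyTTerm_eq x (k := 0) (p := 0) rfl rfl]
      have hpos : Real.Gamma (3 / 2 : ℝ) ≠ 0 := (Real.Gamma_pos_of_pos (by norm_num)).ne'
      have h₀ : airyCoeffH 0 0 = 1 / 6 := by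
        simp [airyCoeffH, hpos]; norm_num
      rw [h₀]
      simp [airyT, airyRST]
      norm_num
    · rw [Finset.sum_eq_zero fun m _ => airyTTerm_of_not (by omega)]
      simp [airyT, airyRST]
    · rw [Finset.sum_eq_single 1 (fun m _ hm => airyTTerm_of_not (by omega)) (by simp),
        airyTTerm_eq x (k := 0) (p := 1) rfl rfl]
      have hpos : Real.Gamma (1 + 3 / 2 : ℝ) ≠ 0 := (Real.Gamma_pos_of_pos (by norm_num)).ne'
      have h₁ : airyCoeffH 1 0 = 1 / 18 := by
        simp [airyCoeffH, hpos]; norm_num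
      rw [h₁, (airyRST_add_three 1).2.2]
      simp [airyT, airyRST]
      ring
    · have hrec := congrArg (eval x) (airyRST_add_three (n + 2)).2.2
      rw [show n + 1 + 1 + 1 + 2 = n + 2 + 3 by ring, hrec, Finset.sum_range_succ',
        airyTTerm_of_not (m := 0) (by omega), add_zero]
      simp only [airyTTerm_succ, Finset.sum_add_distrib, ← Finset.mul_sum]
      rw [← sum_airyTTerm x (n := n) (by omega), ← sum_airyTTerm x (n := n + 1) (by omega),
        ← ih n (by omega), ← ih (n + 1) (by omega)]
      simp only [eval_add, eval_mul, eval_X, eval_ofNat, eval_natCast]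
      push_cast
      ring

theorem airyT_explicit (n : ℕ) (x : ℝ) :
    (airyT (n + 2)).eval x =
      ∑ m ∈ (Finset.range (n + 1)).filter (fun m => n ≤ 3 * m ∧ 2 * m ≤ n),
        airyCoeffH m (n - 2 * m) * 12 ^ (m + 1) * (Nat.factorial m : ℝ) *
          x ^ (3 * m - n) / (Nat.factorial (3 * m - n) : ℝ) := by
  rw [eval_airyT_add_two, Finset.sum_filter]
  rfl
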